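/- arXiv:1812.01927 — 2 statements merged into one kernel-verified Lean document; each statement's English description precedes it below -/
import Mathlib

section
/- For m ≥ 1, the bivariate descent polynomial over odd permutations satisfies A_{2m+1}^-(s,t) = (s+t)·A_{2m}^-(s,t) + st·(∂/∂s + ∂/∂t) A_{2m}^-(s,t), where A_n^-(s,t) = Σ_{π ∈ S_n \ A_n} t^{des(π)} s^{asc(π)}. -/
open Finset

/-- number of descents of a permutation of `Fin n` (one-line notation). -/
def desA {n : ℕ} (π : Equiv.Perm (Fin n)) : ℕ :=
  (Finset.univ.filter (fun i : Fin (n-1) =>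
    π ⟨i.1+1, by have := i.2; omega⟩ < π ⟨i.1, by have := i.2; omega⟩)).card

/-- number of ascents. -/
def ascA {n : ℕ} (π : Equiv.Perm (Fin n)) : ℕ :=
  (Finset.univ.filter (fun i : Fin (n-1) =>
    π ⟨i.1, by have := i.2; omega⟩ < π ⟨i.1+1, by have := i.2; omega⟩)).card

/-- number of inversions. -/
def invA {n : ℕ} (π : Equiv.Perm (Fin n)) : ℕ :=
  (Finset.univ.filter (fun p : Fin n × Fin n => p.1 < p.2 ∧ π p.2 < π p.1)).card

/-- bivariate Eulerian polynomial over all of `S_n`; variable 0 is `s`, variable 1 is `t`. -/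
noncomputable def Abiv (n : ℕ) : MvPolynomial (Fin 2) ℚ :=
  ∑ π : Equiv.Perm (Fin n), MvPolynomial.X 1 ^ desA π * MvPolynomial.X 0 ^ ascA π

noncomputable def AbivP (n : ℕ) : MvPolynomial (Fin 2) ℚ :=
  ∑ π ∈ Finset.univ.filter (fun π : Equiv.Perm (Fin n) => Equiv.Perm.sign π = 1),
    MvPolynomial.X 1 ^ desA π * MvPolynomial.X 0 ^ ascA π

noncomputable def AbivM (n : ℕ) : MvPolynomial (Fin 2) ℚ :=
  ∑ π ∈ Finset.univ.filter (fun π : Equiv.Perm (Fin n) => Equiv.Perm.sign π = -1),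
    MvPolynomial.X 1 ^ desA π * MvPolynomial.X 0 ^ ascA π

noncomputable def Auni (n : ℕ) : Polynomial ℚ :=
  ∑ π : Equiv.Perm (Fin n), Polynomial.X ^ desA π

noncomputable def AuniP (n : ℕ) : Polynomial ℚ :=
  ∑ π ∈ Finset.univ.filter (fun π : Equiv.Perm (Fin n) => Equiv.Perm.sign π = 1),
    Polynomial.X ^ desA π

noncomputable def AuniM (n : ℕ) : Polynomial ℚ :=
  ∑ π ∈ Finset.univ.filter (fun π : Equiv.Perm (Fin n) => Equiv.Perm.sign π = -1),
    Polynomial.X ^ desA π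

/-- the operator `∂/∂s + ∂/∂t`. -/
noncomputable def Dop (f : MvPolynomial (Fin 2) ℚ) : MvPolynomial (Fin 2) ℚ :=
  MvPolynomial.pderiv 0 f + MvPolynomial.pderiv 1 f

/-- A univariate polynomial is palindromic: with `r` the least exponent with nonzero
coefficient and `n` the degree, `a_{r+i} = a_{n-i}`. -/
def Palind (f : Polynomial ℚ) : Prop :=
  ∀ i ≤ f.natDegree - f.natTrailingDegree,
    f.coeff (f.natTrailingDegree + i) = f.coeff (f.natDegree - i)

/-- bivariate gamma positivity with center of symmetry `N/2`. -/
def BivGamma (f : MvPolynomial (Fin 2) ℚ) (N : ℕ) : Prop :=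
  ∃ γ : ℕ → ℕ, (∀ i, γ i ≠ 0 → 2*i ≤ N) ∧
    f = ∑ i ∈ Finset.range (N+1), (γ i : MvPolynomial (Fin 2) ℚ) *
      ((MvPolynomial.X 0 * MvPolynomial.X 1)^i * (MvPolynomial.X 0 + MvPolynomial.X 1)^(N - 2*i))

/-- univariate gamma positivity with center of symmetry `c2/2`. -/
def UniGamma (f : Polynomial ℚ) (c2 : ℕ) : Prop :=
  ∃ γ : ℕ → ℕ, (∀ i, γ i ≠ 0 → 2*i ≤ c2) ∧
    f = ∑ i ∈ Finset.range (c2+1), (γ i : ℚ) •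
      (Polynomial.X^i * (1 + Polynomial.X)^(c2 - 2*i))

/-- signed permutations: a permutation together with a sign for each position. -/
abbrev SignedPerm (n : ℕ) := Equiv.Perm (Fin n) × (Fin n → Bool)

/-- the one-line word of a signed permutation, 1-indexed, with `bw w 0 = 0`;
entry `i` is `±(w.1 i + 1)` viewed in `{-n,…,-1,1,…,n}`. -/
def bw {n : ℕ} (w : SignedPerm n) (i : ℕ) : ℤ :=
  if h : 1 ≤ i ∧ i ≤ n then
    (if w.2 ⟨i-1, by omega⟩ then -(((w.1 ⟨i-1, by omega⟩ : ℕ) : ℤ) + 1)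
     else ((w.1 ⟨i-1, by omega⟩ : ℕ) : ℤ) + 1)
  else 0

/-- type-B descents (including a possible descent at position 0). -/
def desB {n : ℕ} (w : SignedPerm n) : ℕ :=
  ((Finset.range n).filter (fun i => bw w (i+1) < bw w i)).card

/-- type-B inversions (length). -/
def invB {n : ℕ} (w : SignedPerm n) : ℕ :=
  (Finset.univ.filter (fun p : Fin n × Fin n => p.1 < p.2 ∧ bw w (p.2.1+1) < bw w (p.1.1+1))).card
  + (Finset.univ.filter (fun p : Fin n × Fin n => p.1 < p.2 ∧ bw w (p.2.1+1) < -(bw w (p.1.1+1)))).card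
  + (Finset.univ.filter (fun i : Fin n => bw w (i.1+1) < 0)).card

/-- type-D inversions. -/
def invD {n : ℕ} (w : SignedPerm n) : ℕ :=
  (Finset.univ.filter (fun p : Fin n × Fin n => p.1 < p.2 ∧ bw w (p.2.1+1) < bw w (p.1.1+1))).card
  + (Finset.univ.filter (fun p : Fin n × Fin n => p.1 < p.2 ∧ bw w (p.2.1+1) < -(bw w (p.1.1+1)))).card

noncomputable def Bbiv (n : ℕ) : MvPolynomial (Fin 2) ℚ :=
  ∑ w : SignedPerm n, MvPolynomial.X 1 ^ desB w * MvPolynomial.X 0 ^ (n - desB w)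

noncomputable def BbivP (n : ℕ) : MvPolynomial (Fin 2) ℚ :=
  ∑ w ∈ Finset.univ.filter (fun w : SignedPerm n => Even (invB w)),
    MvPolynomial.X 1 ^ desB w * MvPolynomial.X 0 ^ (n - desB w)

noncomputable def BbivM (n : ℕ) : MvPolynomial (Fin 2) ℚ :=
  ∑ w ∈ Finset.univ.filter (fun w : SignedPerm n => ¬ Even (invB w)),
    MvPolynomial.X 1 ^ desB w * MvPolynomial.X 0 ^ (n - desB w)

noncomputable def BuniP (n : ℕ) : Polynomial ℚ :=
  ∑ w ∈ Finset.univ.filter (fun w : SignedPerm n => Even (invB w)), Polynomial.X ^ desB w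

noncomputable def BuniM (n : ℕ) : Polynomial ℚ :=
  ∑ w ∈ Finset.univ.filter (fun w : SignedPerm n => ¬ Even (invB w)), Polynomial.X ^ desB w

/-- deleting the largest letter from the one-line notation of `π ∈ S_{n+1}`
gives a permutation of `[n]`. -/
noncomputable def restrictMax {n : ℕ} (π : Equiv.Perm (Fin (n+1))) : Equiv.Perm (Fin n) :=
  Equiv.ofBijective
    (fun i => Fin.castPred (π ((π.symm (Fin.last n)).succAbove i))
      (by
        intro h
        have h2 : (π.symm (Fin.last n)).succAbove i = π.symm (Fin.last n) := by
          apply π.injective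
          rw [h, Equiv.apply_symm_apply]
        exact Fin.succAbove_ne _ i h2))
    (Finite.injective_iff_bijective.mp (by
      intro i j h
      have h2 : π ((π.symm (Fin.last n)).succAbove i) = π ((π.symm (Fin.last n)).succAbove j) :=
        Fin.castPred_inj.mp h
      have h3 := π.injective h2
      exact Fin.succAbove_right_injective h3))

/-- number of even permutations of `[n]` with `k` descents (`k : ℤ`). -/
noncomputable def aP (n : ℕ) (k : ℤ) : ℕ :=
  (Finset.univ.filter (fun π : Equiv.Perm (Fin n) =>
    Equiv.Perm.sign π = 1 ∧ (desA π : ℤ) = k)).card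

/-- number of odd permutations of `[n]` with `k` descents. -/
noncomputable def aM (n : ℕ) (k : ℤ) : ℕ :=
  (Finset.univ.filter (fun π : Equiv.Perm (Fin n) =>
    Equiv.Perm.sign π = -1 ∧ (desA π : ℤ) = k)).card

/-- The variable recorded by the consecutive letters `a`, `b` of a word: `t` at a descent, `s`
otherwise. -/
noncomputable def stepWeight (a b : ℕ) : MvPolynomial (Fin 2) ℚ :=
  if b < a then MvPolynomial.X 1 else MvPolynomial.X 0

/-- The product of the step weights over the first `N` steps of the word `g`. -/
noncomputable def wordWeight (g : ℕ → ℕ) (N : ℕ) : MvPolynomial (Fin 2) ℚ :=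
  ∏ i ∈ range N, stepWeight (g i) (g (i + 1))

/-- The one-line notation of a permutation, extended by `0`. -/
def oneLine {n : ℕ} (π : Equiv.Perm (Fin n)) (i : ℕ) : ℕ :=
  if h : i < n then π ⟨i, h⟩ else 0

/-- Insert the letter `M` into the word `g` at index `p`. -/
def insertWord (g : ℕ → ℕ) (M p i : ℕ) : ℕ :=
  if i < p then g i else if i = p then M else g (i - 1)

theorem monomial_eq_wordWeight {n : ℕ} (π : Equiv.Perm (Fin n)) :
    MvPolynomial.X 1 ^ desA π * MvPolynomial.X 0 ^ ascA π = wordWeight (oneLine π) (n - 1) := by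
  have hasc : ascA π = (univ.filter fun i : Fin (n - 1) =>
      ¬ π ⟨i.1 + 1, by have := i.2; omega⟩ < π ⟨i.1, by have := i.2; omega⟩).card := by
    unfold ascA
    congr 1
    refine filter_congr fun i _ => ?_
    have hne : π ⟨i.1, by have := i.2; omega⟩ ≠ π ⟨i.1 + 1, by have := i.2; omega⟩ := by
      simp [π.injective.eq_iff]
    rw [not_lt]
    exact ⟨le_of_lt, fun h => lt_of_le_of_ne h hne⟩
  rw [hasc, desA, wordWeight, prod_range, ← prod_const, ← prod_const, ← prod_ite]
  refine prod_congr rfl fun i _ => ?_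
  have h0 : i.1 < n := by have := i.2; omega
  have h1 : i.1 + 1 < n := by have := i.2; omega
  simp [stepWeight, oneLine, h0, h1]

theorem Dop_mul (f g : MvPolynomial (Fin 2) ℚ) : Dop (f * g) = f * Dop g + g * Dop f := by
  simp only [Dop, Derivation.leibniz, smul_eq_mul]
  ring

theorem Dop_sum {ι : Type*} (S : Finset ι) (f : ι → MvPolynomial (Fin 2) ℚ) :
    Dop (∑ i ∈ S, f i) = ∑ i ∈ S, Dop (f i) := by
  simp [Dop, sum_add_distrib]

theorem Dop_stepWeight (a b : ℕ) : Dop (stepWeight a b) = 1 := by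
  unfold stepWeight Dop
  split_ifs <;> simp [MvPolynomial.pderiv_X]

theorem wordWeight_congr {g h : ℕ → ℕ} {N : ℕ} (H : ∀ i ≤ N, g i = h i) :
    wordWeight g N = wordWeight h N := by
  refine prod_congr rfl fun i hi => ?_
  rw [mem_range] at hi
  rw [H i (by omega), H (i + 1) (by omega)]

theorem wordWeight_succ (g : ℕ → ℕ) (N : ℕ) :
    wordWeight g (N + 1) = wordWeight g N * stepWeight (g N) (g (N + 1)) :=
  prod_range_succ _ _

theorem wordWeight_insertWord_last {g : ℕ → ℕ} {M N : ℕ} (hg : g N < M) :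
    wordWeight (insertWord g M (N + 1)) (N + 1) = MvPolynomial.X 0 * wordWeight g N := by
  have h : wordWeight (insertWord g M (N + 1)) N = wordWeight g N :=
    wordWeight_congr fun i hi => by simp [insertWord, Nat.lt_succ_of_le hi]
  rw [wordWeight_succ, h]
  simp [insertWord, stepWeight, hg.le, mul_comm]

theorem sum_wordWeight_insertWord_of_le {g : ℕ → ℕ} {M N : ℕ} (hg : ∀ i ≤ N, g i < M) :
    ∑ p ∈ range (N + 1), wordWeight (insertWord g M p) (N + 1) =
      MvPolynomial.X 1 * wordWeight g N
        + MvPolynomial.X 0 * MvPolynomial.X 1 * Dop (wordWeight g N) := by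
  induction N with
  | zero => simp [wordWeight, insertWord, stepWeight, hg 0 le_rfl, Dop]
  | succ N ih =>
    rw [sum_range_succ, wordWeight_succ _ (N + 1), wordWeight_insertWord_last (hg N (by omega))]
    have h : ∀ p ∈ range (N + 1), wordWeight (insertWord g M p) (N + 1 + 1) =
        wordWeight (insertWord g M p) (N + 1) * stepWeight (g N) (g (N + 1)) := by
      intro p hp
      rw [mem_range] at hp
      rw [wordWeight_succ _ (N + 1)]
      congr 2
      · simp [insertWord, show ¬ N + 1 < p by omega, show N + 1 ≠ p by omega]
      · simp [insertWord, show ¬ N + 1 + 1 < p by omega, show N + 1 + 1 ≠ p by omega]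
    rw [sum_congr rfl h, ← sum_mul, ih fun i hi => hg i (by omega), wordWeight_succ g N, Dop_mul,
      Dop_stepWeight]
    have hs : stepWeight (insertWord g M (N + 1) (N + 1)) (insertWord g M (N + 1) (N + 1 + 1)) =
        MvPolynomial.X 1 := by
      simp [insertWord, stepWeight, hg (N + 1) le_rfl]
    rw [hs]
    ring

theorem sum_wordWeight_insertWord {g : ℕ → ℕ} {M N : ℕ} (hg : ∀ i ≤ N, g i < M) :
    ∑ p ∈ range (N + 2), wordWeight (insertWord g M p) (N + 1) =
      (MvPolynomial.X 0 + MvPolynomial.X 1) * wordWeight g N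
        + MvPolynomial.X 0 * MvPolynomial.X 1 * Dop (wordWeight g N) := by
  rw [sum_range_succ, sum_wordWeight_insertWord_of_le hg, wordWeight_insertWord_last (hg N le_rfl)]
  ring

/-- Insert the largest letter into the one-line notation of `π` at position `p`. -/
def insertMax {n : ℕ} (π : Equiv.Perm (Fin n)) (p : Fin (n + 1)) : Equiv.Perm (Fin (n + 1)) :=
  (finRotate (n + 1))⁻¹ * Equiv.Perm.decomposeFin.symm (0, π) * p.cycleRange

theorem insertMax_apply_self {n : ℕ} (π : Equiv.Perm (Fin n)) (p : Fin (n + 1)) :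
    insertMax π p p = Fin.last n := by
  rw [insertMax, Equiv.Perm.mul_apply, Equiv.Perm.mul_apply, Equiv.Perm.inv_eq_iff_eq,
    finRotate_last, Fin.cycleRange_self, Equiv.Perm.decomposeFin_symm_apply_zero]

theorem insertMax_apply_succAbove {n : ℕ} (π : Equiv.Perm (Fin n)) (p : Fin (n + 1)) (j : Fin n) :
    insertMax π p (p.succAbove j) = (π j).castSucc := by
  rw [insertMax, Equiv.Perm.mul_apply, Equiv.Perm.mul_apply, Equiv.Perm.inv_eq_iff_eq]
  simp

theorem insertMax_symm_last {n : ℕ} (π : Equiv.Perm (Fin n)) (p : Fin (n + 1)) :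
    (insertMax π p).symm (Fin.last n) = p := by
  rw [Equiv.symm_apply_eq, insertMax_apply_self]

theorem sign_insertMax {n : ℕ} (π : Equiv.Perm (Fin n)) (p : Fin (n + 1)) :
    Equiv.Perm.sign (insertMax π p) =
      (-1) ^ n * Equiv.Perm.sign π * (-1) ^ (p : ℕ) := by
  simp [insertMax, sign_finRotate]

theorem insertMax_bijective (n : ℕ) :
    Function.Bijective fun x : Equiv.Perm (Fin n) × Fin (n + 1) => insertMax x.1 x.2 := by
  rw [Fintype.bijective_iff_injective_and_card]
  constructor
  · rintro ⟨π, p⟩ ⟨ρ, q⟩ h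
    simp only at h
    obtain rfl : p = q := by rw [← insertMax_symm_last π p, h, insertMax_symm_last]
    congr 1
    ext j : 1
    rw [← Fin.castSucc_inj, ← insertMax_apply_succAbove π p, h, insertMax_apply_succAbove]
  · simp [Fintype.card_perm, Nat.factorial_succ, mul_comm]

theorem oneLine_insertMax {n : ℕ} (π : Equiv.Perm (Fin n)) (p : Fin (n + 1)) {i : ℕ} (hi : i ≤ n) :
    oneLine (insertMax π p) i = insertWord (oneLine π) n p i := by
  have hi' : i < n + 1 := by omega
  unfold insertWord
  rw [oneLine, dif_pos hi']
  split_ifs with h1 h2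
  · have hn : i < n := by have := p.2; omega
    have h := insertMax_apply_succAbove π p ⟨i, hn⟩
    rw [Fin.succAbove_of_castSucc_lt _ _ (by simpa [Fin.lt_def] using h1)] at h
    simp only [Fin.castSucc_mk] at h
    rw [h]
    simp [oneLine, hn]
  · have : (⟨i, hi'⟩ : Fin (n + 1)) = p := Fin.ext h2
    rw [this, insertMax_apply_self, Fin.val_last]
  · have hn : i - 1 < n := by omega
    have h := insertMax_apply_succAbove π p ⟨i - 1, hn⟩
    rw [Fin.succAbove_of_le_castSucc _ _ (by rw [Fin.le_def]; simp; omega)] at h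
    simp only [Fin.succ_mk, show i - 1 + 1 = i by omega] at h
    rw [h]
    simp [oneLine, hn]

theorem sum_wordWeight_insertMax {n : ℕ} (hn : 1 ≤ n) (π : Equiv.Perm (Fin n)) :
    ∑ p : Fin (n + 1), wordWeight (oneLine (insertMax π p)) n =
      (MvPolynomial.X 0 + MvPolynomial.X 1) * wordWeight (oneLine π) (n - 1)
        + MvPolynomial.X 0 * MvPolynomial.X 1 * Dop (wordWeight (oneLine π) (n - 1)) := by
  obtain ⟨N, rfl⟩ := Nat.exists_eq_add_of_le' hn
  rw [Nat.add_sub_cancel, ← sum_wordWeight_insertWord (M := N + 1), sum_range]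
  · exact sum_congr rfl fun p _ => wordWeight_congr fun i hi => oneLine_insertMax π p hi
  · intro i hi
    simp [oneLine, Nat.lt_succ_of_le hi, -Order.lt_add_one_iff]

/-- The smaller letter of the `k`-th pair of letters. -/
def lowLetter {m : ℕ} (k : Fin m) : Fin (2 * m + 1) := ⟨2 * k, by omega⟩

/-- The larger letter of the `k`-th pair of letters. -/
def highLetter {m : ℕ} (k : Fin m) : Fin (2 * m + 1) := ⟨2 * k + 1, by omega⟩

/-- The letters of the `k`-th pair occupy adjacent positions. -/
def PairAdjacent {m : ℕ} (σ : Equiv.Perm (Fin (2 * m + 1))) (k : Fin m) : Prop :=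
  (σ.symm (lowLetter k) : ℕ) + 1 = σ.symm (highLetter k) ∨
    (σ.symm (highLetter k) : ℕ) + 1 = σ.symm (lowLetter k)

theorem lowLetter_ne_highLetter {m : ℕ} (k : Fin m) : lowLetter k ≠ highLetter k := by
  simp [lowLetter, highLetter]

theorem pairAdjacent_swap_mul {m : ℕ} (σ : Equiv.Perm (Fin (2 * m + 1))) (k j : Fin m) :
    PairAdjacent (Equiv.swap (lowLetter k) (highLetter k) * σ) j ↔ PairAdjacent σ j := by
  have hsymm : ∀ x, (Equiv.swap (lowLetter k) (highLetter k) * σ).symm x =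
      σ.symm (Equiv.swap (lowLetter k) (highLetter k) x) := fun x => by
    rw [Equiv.symm_apply_eq]; simp
  unfold PairAdjacent
  rw [hsymm, hsymm]
  by_cases h : j = k
  · subst h
    rw [Equiv.swap_apply_left, Equiv.swap_apply_right, or_comm]
  · have hv : (j : ℕ) ≠ k := fun e => h (Fin.ext e)
    rw [Equiv.swap_apply_of_ne_of_ne, Equiv.swap_apply_of_ne_of_ne] <;>
      simp only [lowLetter, highLetter, ne_eq, Fin.mk.injEq] <;> omega

theorem wordWeight_swap_mul {m : ℕ} (σ : Equiv.Perm (Fin (2 * m + 1))) (k : Fin m)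
    (hk : ¬ PairAdjacent σ k) :
    wordWeight (oneLine (Equiv.swap (lowLetter k) (highLetter k) * σ)) (2 * m) =
      wordWeight (oneLine σ) (2 * m) := by
  refine prod_congr rfl fun i hi => ?_
  rw [mem_range] at hi
  have h0 : i < 2 * m + 1 := by omega
  have h1 : i + 1 < 2 * m + 1 := by omega
  simp only [oneLine, h0, h1, dif_pos, Equiv.Perm.mul_apply]
  have hlh : ¬ (σ ⟨i, h0⟩ = lowLetter k ∧ σ ⟨i + 1, h1⟩ = highLetter k) := by
    rintro ⟨ha, hb⟩
    exact hk (Or.inl (by rw [← ha, ← hb]; simp))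
  have hhl : ¬ (σ ⟨i, h0⟩ = highLetter k ∧ σ ⟨i + 1, h1⟩ = lowLetter k) := by
    rintro ⟨ha, hb⟩
    exact hk (Or.inr (by rw [← ha, ← hb]; simp))
  have hne : σ ⟨i, h0⟩ ≠ σ ⟨i + 1, h1⟩ := by simp [σ.injective.eq_iff]
  generalize σ ⟨i, h0⟩ = a at *
  generalize σ ⟨i + 1, h1⟩ = b at *
  unfold stepWeight
  congr 1
  simp only [Equiv.swap_apply_def, lowLetter, highLetter, Fin.ext_iff, ne_eq, eq_iff_iff] at *
  split_ifs <;> (try dsimp only) <;> omega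

theorem even_position_last {m : ℕ} (σ : Equiv.Perm (Fin (2 * m + 1)))
    (h : ∀ k, PairAdjacent σ k) : Even (σ.symm (Fin.last (2 * m)) : ℕ) := by
  set p := σ.symm (Fin.last (2 * m))
  have hcount : ∑ v : Fin (2 * m + 1), (if σ.symm v < p then 1 else 0) = (p : ℕ) := by
    rw [Equiv.sum_comp σ.symm fun i => if i < p then 1 else 0, ← sum_filter, ← card_eq_sum_ones,
      filter_gt_eq_Iio, Fin.card_Iio]
  have hpair : ∀ f : ℕ → ℕ, ∀ r, ∑ v ∈ range (2 * r), f v =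
      ∑ k ∈ range r, (f (2 * k) + f (2 * k + 1)) := by
    intro f r
    induction r with
    | zero => simp
    | succ r ih => rw [mul_add, sum_range_succ, sum_range_succ, ih, sum_range_succ, add_assoc]
  let f : ℕ → ℕ := fun v =>
    if h : v < 2 * m + 1 then (if σ.symm ⟨v, h⟩ < p then 1 else 0) else 0
  have hf : ∑ v : Fin (2 * m + 1), (if σ.symm v < p then 1 else 0) =
      ∑ v ∈ range (2 * m + 1), f v := by
    rw [sum_range]
    exact sum_congr rfl fun v _ => by simp only [f, v.2, dif_pos]
  have hlast : f (2 * m) = 0 := by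
    simp only [f, Nat.lt_succ_self, dif_pos]
    exact if_neg (lt_irrefl p)
  rw [← hcount, hf, sum_range_succ, hlast, add_zero, hpair]
  refine even_sum _ fun k hk => ?_
  rw [mem_range] at hk
  have hlow : (lowLetter ⟨k, hk⟩ : Fin (2 * m + 1)) ≠ Fin.last (2 * m) := by
    simp only [lowLetter, ne_eq, Fin.ext_iff, Fin.val_last]; omega
  have hhigh : (highLetter ⟨k, hk⟩ : Fin (2 * m + 1)) ≠ Fin.last (2 * m) := by
    simp only [highLetter, ne_eq, Fin.ext_iff, Fin.val_last]; omega
  have hlp : (σ.symm (lowLetter ⟨k, hk⟩) : ℕ) ≠ p := fun e => hlow (σ.symm.injective (Fin.ext e))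
  have hhp : (σ.symm (highLetter ⟨k, hk⟩) : ℕ) ≠ p :=
    fun e => hhigh (σ.symm.injective (Fin.ext e))
  have hfe : f (2 * k) = f (2 * k + 1) := by
    simp only [f, show 2 * k < 2 * m + 1 by omega, show 2 * k + 1 < 2 * m + 1 by omega, dif_pos]
    refine if_congr ?_ rfl rfl
    have := h ⟨k, hk⟩
    unfold PairAdjacent at this
    change σ.symm (lowLetter ⟨k, hk⟩) < p ↔ σ.symm (highLetter ⟨k, hk⟩) < p
    rw [Fin.lt_def, Fin.lt_def]
    omega
  rw [hfe]
  exact ⟨_, rfl⟩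

/-- Permutations of `2 * m + 1` letters admit an involution which preserves the weight and the
position of the largest letter, and reverses the sign exactly when that position is odd. -/
theorem exists_signReversing_involution {m : ℕ} (hm : 1 ≤ m) :
    ∃ Ψ : Equiv.Perm (Fin (2 * m + 1)) → Equiv.Perm (Fin (2 * m + 1)), ∀ σ,
      Ψ (Ψ σ) = σ ∧ (Ψ σ).symm (Fin.last (2 * m)) = σ.symm (Fin.last (2 * m)) ∧
      Equiv.Perm.sign (Ψ σ) =
        Equiv.Perm.sign σ * (-1) ^ (σ.symm (Fin.last (2 * m)) : ℕ) ∧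
      wordWeight (oneLine (Ψ σ)) (2 * m) = wordWeight (oneLine σ) (2 * m) := by
  classical
  obtain ⟨pick, hpick⟩ : ∃ pick : Finset (Fin m) → Fin m, ∀ s, s.Nonempty → pick s ∈ s := by
    have : ∀ s : Finset (Fin m), ∃ k, s.Nonempty → k ∈ s := fun s => by
      by_cases hs : s.Nonempty
      · exact ⟨hs.choose, fun _ => hs.choose_spec⟩
      · exact ⟨⟨0, hm⟩, fun h => absurd h hs⟩
    choose pick hpick using this
    exact ⟨pick, hpick⟩
  let k : Equiv.Perm (Fin (2 * m + 1)) → Fin m := fun σ =>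
    pick (univ.filter fun j => ¬ PairAdjacent σ j)
  let Φ : Equiv.Perm (Fin (2 * m + 1)) → Equiv.Perm (Fin (2 * m + 1)) := fun σ =>
    Equiv.swap (lowLetter (k σ)) (highLetter (k σ)) * σ
  have hk : ∀ σ, k (Φ σ) = k σ := fun σ => by simp only [k, Φ, pairAdjacent_swap_mul]
  have hΦ : ∀ σ, Φ (Φ σ) = σ := fun σ => by
    change Equiv.swap (lowLetter (k (Φ σ))) (highLetter (k (Φ σ))) * Φ σ = σ
    rw [hk]
    exact Equiv.swap_mul_self_mul _ _ _
  have hlast : ∀ σ, (Φ σ).symm (Fin.last (2 * m)) = σ.symm (Fin.last (2 * m)) := fun σ => by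
    rw [Equiv.symm_apply_eq]
    simp only [Φ, Equiv.Perm.mul_apply, Equiv.apply_symm_apply]
    rw [Equiv.swap_apply_of_ne_of_ne] <;>
      simp only [lowLetter, highLetter, ne_eq, Fin.ext_iff, Fin.val_last] <;> omega
  refine ⟨fun σ => if Even (σ.symm (Fin.last (2 * m)) : ℕ) then σ else Φ σ, fun σ => ?_⟩
  by_cases hσ : Even (σ.symm (Fin.last (2 * m)) : ℕ)
  · simp [hσ, hσ.neg_one_pow]
  · have hbad : ¬ PairAdjacent σ (k σ) := by
      have hne : (univ.filter fun j => ¬ PairAdjacent σ j).Nonempty := by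
        by_contra hemp
        refine hσ (even_position_last σ fun j => ?_)
        by_contra hj
        exact hemp ⟨j, by simpa using hj⟩
      exact (mem_filter.mp (hpick _ hne)).2
    simp only [hσ, hlast, if_false, hΦ, true_and]
    refine ⟨?_, wordWeight_swap_mul σ _ hbad⟩
    rw [(Nat.not_even_iff_odd.mp hσ).neg_one_pow, Equiv.Perm.sign_mul,
      Equiv.Perm.sign_swap (lowLetter_ne_highLetter _), mul_comm (-1 : ℤˣ)]

theorem sum_odd_eq_sum_twisted {m : ℕ} (hm : 1 ≤ m) :
    ∑ σ ∈ univ.filter (fun σ : Equiv.Perm (Fin (2 * m + 1)) => Equiv.Perm.sign σ = -1),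
        wordWeight (oneLine σ) (2 * m) =
      ∑ σ ∈ univ.filter (fun σ : Equiv.Perm (Fin (2 * m + 1)) =>
        Equiv.Perm.sign σ * (-1) ^ (σ.symm (Fin.last (2 * m)) : ℕ) = -1),
          wordWeight (oneLine σ) (2 * m) := by
  obtain ⟨Ψ, hΨ⟩ := exists_signReversing_involution hm
  refine sum_nbij' Ψ Ψ (fun σ hσ => ?_) (fun σ hσ => ?_) (fun σ _ => (hΨ σ).1)
    (fun σ _ => (hΨ σ).1) fun σ _ => (hΨ σ).2.2.2.symm
  · obtain ⟨-, hlast, hsign, -⟩ := hΨ σ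
    rw [mem_filter] at hσ ⊢
    rw [hlast, hsign, mul_assoc, ← mul_pow]
    simpa using hσ.2
  · rw [mem_filter] at hσ ⊢
    exact ⟨mem_univ _, (hΨ σ).2.2.1.trans hσ.2⟩

theorem AbivM_odd_recurrence (m : ℕ) (hm : 1 ≤ m) :
    AbivM (2*m+1) = (MvPolynomial.X 0 + MvPolynomial.X 1) * AbivM (2*m)
      + MvPolynomial.X 0 * MvPolynomial.X 1 * Dop (AbivM (2*m)) := by
  simp only [AbivM, monomial_eq_wordWeight, Nat.add_sub_cancel]
  rw [sum_odd_eq_sum_twisted hm, Dop_sum, mul_sum, mul_sum, ← sum_add_distrib]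
  rw [← sum_congr rfl fun π _ => sum_wordWeight_insertMax (by omega : 1 ≤ 2 * m) π, sum_filter,
    ← (insertMax_bijective (2 * m)).sum_comp, Fintype.sum_prod_type, sum_filter]
  refine sum_congr rfl fun π _ => ?_
  have hsign : ∀ p : Fin (2 * m + 1),
      Equiv.Perm.sign (insertMax π p) * (-1) ^ (p : ℕ) = Equiv.Perm.sign π := fun p => by
    rw [sign_insertMax, mul_assoc, ← mul_pow]
    simp
  simp only [insertMax_symm_last, hsign]
  split_ifs <;> simp
end

section
/- For m ≥ 1, the univariate polynomial A_{4m+2}^+(t) = Σ_{π ∈ A_{4m+2}} t^{des(π)} can be written as w_1(t) + w_2(t), where w_1 and w_2 are gamma positive polynomials (nonnegative combinations of t^{r+i}(1+t)^{n-r-2i}) with centers of symmetry 2m and 2m+1 respectively. -/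
open Finset

/-- The one-line word of a permutation of `Fin n`, read at the positions `1, …, n` and bordered
by the value `n`. -/
def borderedWord {n : ℕ} (π : Equiv.Perm (Fin n)) (i : ℕ) : ℕ :=
  if h : 1 ≤ i ∧ i ≤ n then π ⟨i - 1, by omega⟩ else n

/-- The number of descents of the bordered word. -/
def borderedDes {n : ℕ} (π : Equiv.Perm (Fin n)) : ℕ :=
  ((range (n + 1)).filter fun i => borderedWord π (i + 1) < borderedWord π i).card

theorem borderedDes_eq_desA_succ {n : ℕ} (π : Equiv.Perm (Fin (n + 1))) :
    borderedDes π = desA π + 1 := by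
  have first : borderedWord π 1 < borderedWord π 0 := by
    have := (π 0).2
    simp [borderedWord]
    omega
  have final : ¬ borderedWord π (n + 1 + 1) < borderedWord π (n + 1) := by
    simp [borderedWord]
  rw [borderedDes, desA, card_filter, card_filter, sum_range_succ, sum_range_succ',
    if_pos first, if_neg final, Finset.sum_range]
  refine congrArg (· + 1) (sum_congr rfl fun i _ => ?_)
  have hi : (i : ℕ) < n := i.2
  have h1 : (i : ℕ) + 1 < n + 1 := by omega
  have h2 : (i : ℕ) + 1 ≤ n + 1 := by omega
  simp [borderedWord, h2, hi]

/-- Insert a new minimum at position `p`. -/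
def insertMin {n : ℕ} (p : Fin (n + 1)) (π : Equiv.Perm (Fin n)) : Equiv.Perm (Fin (n + 1)) :=
  Equiv.Perm.decomposeFin.symm (0, π) * p.cycleRange

@[simp]
theorem insertMin_self {n : ℕ} (p : Fin (n + 1)) (π : Equiv.Perm (Fin n)) :
    insertMin p π p = 0 := by
  simp [insertMin]

@[simp]
theorem insertMin_succAbove {n : ℕ} (p : Fin (n + 1)) (π : Equiv.Perm (Fin n)) (i : Fin n) :
    insertMin p π (p.succAbove i) = (π i).succ := by
  simp [insertMin]

theorem sign_insertMin {n : ℕ} (p : Fin (n + 1)) (π : Equiv.Perm (Fin n)) :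
    Equiv.Perm.sign (insertMin p π) = (-1) ^ (p : ℕ) * Equiv.Perm.sign π := by
  simp [insertMin, mul_comm]

theorem insertMin_bijective (n : ℕ) :
    Function.Bijective fun x : Fin (n + 1) × Equiv.Perm (Fin n) => insertMin x.1 x.2 := by
  rw [Fintype.bijective_iff_injective_and_card]
  refine ⟨?_, by simp [Fintype.card_perm, Nat.factorial_succ]⟩
  rintro ⟨p, π⟩ ⟨q, σ⟩ h
  simp only at h
  obtain rfl : p = q := by
    apply (insertMin q σ).injective
    rw [insertMin_self, ← h, insertMin_self]
  simpa [insertMin] using h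

theorem sum_perm_succ {M : Type*} [AddCommMonoid M] {n : ℕ} (f : Equiv.Perm (Fin (n + 1)) → M) :
    ∑ π, f π = ∑ π : Equiv.Perm (Fin n), ∑ p, f (insertMin p π) := by
  rw [← (insertMin_bijective n).sum_comp, Fintype.sum_prod_type_right]

theorem borderedWord_insertMin {n : ℕ} (p : Fin (n + 1)) (π : Equiv.Perm (Fin n)) (i : ℕ) :
    borderedWord (insertMin p π) i =
      if i ≤ p then borderedWord π i + 1 else
        if i = p + 1 then 0 else borderedWord π (i - 1) + 1 := by
  have hp := p.2
  by_cases h : 1 ≤ i ∧ i ≤ n + 1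
  · rcases lt_trichotomy i (p + 1) with hi | hi | hi
    · have hin : i - 1 < n := by omega
      have : (⟨i - 1, by omega⟩ : Fin (n + 1)) = p.succAbove ⟨i - 1, hin⟩ := by
        rw [Fin.succAbove_of_castSucc_lt _ _ (by simp [Fin.lt_def]; omega)]
        rfl
      rw [borderedWord, dif_pos h, this, insertMin_succAbove, if_pos (by omega), borderedWord,
        dif_pos (by omega), Fin.val_succ]
    · have : (⟨i - 1, by omega⟩ : Fin (n + 1)) = p := by
        ext
        simp [hi]
      rw [borderedWord, dif_pos h, this, insertMin_self, if_neg (by omega), if_pos hi]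
      rfl
    · have hin : i - 1 - 1 < n := by omega
      have : (⟨i - 1, by omega⟩ : Fin (n + 1)) = p.succAbove ⟨i - 1 - 1, hin⟩ := by
        rw [Fin.succAbove_of_le_castSucc _ _ (by simp [Fin.le_def]; omega)]
        ext
        simp
        omega
      rw [borderedWord, dif_pos h, this, insertMin_succAbove, if_neg (by omega),
        if_neg (by omega), borderedWord, dif_pos (by omega), Fin.val_succ]
  · rw [borderedWord, dif_neg h]
    split_ifs
    · rw [borderedWord, dif_neg (by omega)]
    · omega
    · rw [borderedWord, dif_neg (by omega)]

theorem borderedDes_insertMin {n : ℕ} (p : Fin (n + 1)) (π : Equiv.Perm (Fin n)) :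
    borderedDes (insertMin p π) =
      borderedDes π + if borderedWord π (p + 1) < borderedWord π p then 0 else 1 := by
  have hp := p.2
  obtain ⟨k, hk⟩ : ∃ k, n = p + k := ⟨n - p, by omega⟩
  rw [borderedDes, borderedDes, card_filter, card_filter,
    show range (n + 1 + 1) = range (p + (k + 1 + 1)) from congrArg range (by omega),
    show range (n + 1) = range (p + (k + 1)) from congrArg range (by omega),
    sum_range_add _ p (k + 1 + 1), sum_range_succ' _ (k + 1), sum_range_succ' _ k,
    sum_range_add _ p (k + 1), sum_range_succ' _ k]
  have below : ∀ i ∈ range (p : ℕ),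
      (if borderedWord (insertMin p π) (i + 1) < borderedWord (insertMin p π) i then 1 else 0) =
        if borderedWord π (i + 1) < borderedWord π i then 1 else 0 := by
    intro i hi
    have hi' := mem_range.mp hi
    have e : borderedWord (insertMin p π) i = borderedWord π i + 1 := by
      rw [borderedWord_insertMin, if_pos (by omega)]
    have e' : borderedWord (insertMin p π) (i + 1) = borderedWord π (i + 1) + 1 := by
      rw [borderedWord_insertMin, if_pos (by omega)]
    simp [e, e']
  have above : ∀ i ∈ range k,
      (if borderedWord (insertMin p π) (p + (i + 1 + 1) + 1) <
        borderedWord (insertMin p π) (p + (i + 1 + 1)) then 1 else 0) =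
        if borderedWord π (p + (i + 1) + 1) < borderedWord π (p + (i + 1)) then 1 else 0 := by
    intro i hi
    have e : borderedWord (insertMin p π) (p + (i + 1 + 1)) =
        borderedWord π (p + (i + 1)) + 1 := by
      rw [borderedWord_insertMin, if_neg (by omega), if_neg (by omega)]
      rfl
    have e' : borderedWord (insertMin p π) (p + (i + 1 + 1) + 1) =
        borderedWord π (p + (i + 1) + 1) + 1 := by
      rw [borderedWord_insertMin, if_neg (by omega), if_neg (by omega)]
      rfl
    simp [e, e']
  have before : borderedWord (insertMin p π) (p + 0 + 1) <
      borderedWord (insertMin p π) (p + 0) := by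
    simp [borderedWord_insertMin]
  have after : ¬ borderedWord (insertMin p π) (p + (0 + 1) + 1) <
      borderedWord (insertMin p π) (p + (0 + 1)) := by
    simp [borderedWord_insertMin]
  rw [sum_congr rfl below, sum_congr rfl above, if_pos before, if_neg after]
  simp only [add_zero]
  split_ifs <;> omega

/-- The operator taking the bordered Eulerian polynomial of order `n` to the one of
order `n + 1`. -/
noncomputable def eulerOp (n : ℕ) (f : Polynomial ℚ) : Polynomial ℚ :=
  ((n : Polynomial ℚ) + 1) * Polynomial.X * f +
    Polynomial.X * (1 - Polynomial.X) * Polynomial.derivative f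

theorem sum_insertMin_pow {n : ℕ} (π : Equiv.Perm (Fin n)) :
    ∑ p, (Polynomial.X : Polynomial ℚ) ^ borderedDes (insertMin p π) =
      eulerOp n (Polynomial.X ^ borderedDes π) := by
  have key : ∀ p : Fin (n + 1), (Polynomial.X : Polynomial ℚ) ^ borderedDes (insertMin p π) =
      Polynomial.X * Polynomial.X ^ borderedDes π +
        (if borderedWord π (p + 1) < borderedWord π p then 1 else 0) *
          ((1 - Polynomial.X) * Polynomial.X ^ borderedDes π) := by
    intro p
    rw [borderedDes_insertMin]
    split_ifs <;> ring
  have count : ∑ p : Fin (n + 1),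
      (if borderedWord π (p + 1) < borderedWord π p then (1 : Polynomial ℚ) else 0) =
        borderedDes π := by
    rw [borderedDes, card_filter, Finset.sum_range]
    push_cast
    rfl
  rw [sum_congr rfl fun p _ => key p, sum_add_distrib, sum_const, ← sum_mul, count, eulerOp,
    Polynomial.derivative_X_pow]
  simp only [card_univ, Fintype.card_fin, nsmul_eq_mul, map_natCast]
  rcases hd : borderedDes π with _ | d
  · push_cast
    ring
  · push_cast [Nat.add_sub_cancel]
    ring

/-- The Eulerian polynomial counting permutations by bordered descents. -/
noncomputable def borderedEulerian (n : ℕ) : Polynomial ℚ :=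
  ∑ π : Equiv.Perm (Fin n), Polynomial.X ^ borderedDes π

/-- The signed Eulerian polynomial with respect to bordered descents. -/
noncomputable def signedEulerian (n : ℕ) : Polynomial ℚ :=
  ∑ π : Equiv.Perm (Fin n), ((Equiv.Perm.sign π : ℤ) : Polynomial ℚ) * Polynomial.X ^ borderedDes π

theorem eulerOp_sum {ι : Type*} (n : ℕ) (s : Finset ι) (f : ι → Polynomial ℚ) :
    eulerOp n (∑ i ∈ s, f i) = ∑ i ∈ s, eulerOp n (f i) := by
  simp only [eulerOp, Polynomial.derivative_sum, mul_sum, sum_add_distrib]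

theorem eulerOp_intCast_mul (n : ℕ) (c : ℤ) (f : Polynomial ℚ) :
    eulerOp n (c * f) = c * eulerOp n f := by
  simp only [eulerOp, Polynomial.derivative_mul, Polynomial.derivative_intCast]
  ring

theorem borderedEulerian_zero : borderedEulerian 0 = 1 := by
  have h (π : Equiv.Perm (Fin 0)) : borderedDes π = 0 := by
    refine card_eq_zero.mpr (filter_eq_empty_iff.mpr fun i _ => ?_)
    rw [not_lt, borderedWord, dif_neg (by omega)]
    exact Nat.zero_le _
  simp [borderedEulerian, h]

theorem borderedEulerian_succ (n : ℕ) :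
    borderedEulerian (n + 1) = eulerOp n (borderedEulerian n) := by
  rw [borderedEulerian, sum_perm_succ, borderedEulerian, eulerOp_sum]
  exact sum_congr rfl fun π _ => sum_insertMin_pow π

/-- The two smallest letters occupy neighbouring positions. -/
def MinAdjacent {n : ℕ} (π : Equiv.Perm (Fin (n + 2))) : Prop :=
  (π.symm 0 : ℕ) + 1 = π.symm 1 ∨ (π.symm 1 : ℕ) + 1 = π.symm 0

theorem borderedWord_eq_iff {n : ℕ} (π : Equiv.Perm (Fin n)) (v : Fin n) (i : ℕ) :
    borderedWord π i = v ↔ i = π.symm v + 1 := by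
  have hv := v.2
  constructor
  · intro h
    rw [borderedWord] at h
    split_ifs at h with hi
    · rw [← Fin.ext h, Equiv.symm_apply_apply]
      simp
      omega
    · omega
  · rintro rfl
    simp [borderedWord]

theorem borderedWord_swap_mul {n : ℕ} (π : Equiv.Perm (Fin (n + 2))) (i : ℕ) :
    borderedWord (Equiv.swap 0 1 * π) i =
      if borderedWord π i = 0 then 1 else if borderedWord π i = 1 then 0
        else borderedWord π i := by
  unfold borderedWord
  by_cases h : 1 ≤ i ∧ i ≤ n + 2
  · rw [dif_pos h, dif_pos h, Equiv.Perm.mul_apply, Equiv.swap_apply_def]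
    simp only [Fin.ext_iff]
    split_ifs <;> simp_all
  · simp [h]

theorem borderedDes_swap_mul {n : ℕ} (π : Equiv.Perm (Fin (n + 2))) (h : ¬ MinAdjacent π) :
    borderedDes (Equiv.swap 0 1 * π) = borderedDes π := by
  refine congrArg card (filter_congr fun i _ => ?_)
  rw [borderedWord_swap_mul, borderedWord_swap_mul]
  have h0 := borderedWord_eq_iff π 0
  have h1 := borderedWord_eq_iff π 1
  simp only [Fin.val_zero, Fin.val_one] at h0 h1
  have hi0 := h0 i
  have hi1 := h1 i
  have hj0 := h0 (i + 1)
  have hj1 := h1 (i + 1)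
  unfold MinAdjacent at h
  split_ifs <;> omega

theorem minAdjacent_swap_mul {n : ℕ} (π : Equiv.Perm (Fin (n + 2))) :
    MinAdjacent (Equiv.swap 0 1 * π) ↔ MinAdjacent π := by
  have h : ∀ v, (Equiv.swap 0 1 * π).symm v = π.symm (Equiv.swap 0 1 v) := fun v => by
    rw [Equiv.symm_apply_eq, Equiv.Perm.mul_apply, Equiv.apply_symm_apply, Equiv.swap_apply_self]
  simp only [MinAdjacent, h, Equiv.swap_apply_left, Equiv.swap_apply_right]
  exact or_comm

open Classical in
theorem sum_not_minAdjacent (n : ℕ) :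
    ∑ π : Equiv.Perm (Fin (n + 2)), (if MinAdjacent π then 0 else
      ((Equiv.Perm.sign π : ℤ) : Polynomial ℚ) * Polynomial.X ^ borderedDes π) = 0 := by
  refine self_eq_neg.mp
    ((Equiv.sum_comp (Equiv.mulLeft (Equiv.swap (0 : Fin (n + 2)) 1)) _).symm.trans ?_)
  rw [← sum_neg_distrib]
  refine sum_congr rfl fun π _ => ?_
  simp only [Equiv.coe_mulLeft, minAdjacent_swap_mul]
  split_ifs with h
  · simp
  · rw [borderedDes_swap_mul π h, Equiv.Perm.sign_mul, Equiv.Perm.sign_swap (by simp)]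
    simp

theorem minAdjacent_insertMin {n : ℕ} (p : Fin (n + 2)) (π : Equiv.Perm (Fin (n + 1))) :
    MinAdjacent (insertMin p π) ↔ p = (π.symm 0).castSucc ∨ p = (π.symm 0).succ := by
  have h0 : (insertMin p π).symm 0 = p := by
    rw [Equiv.symm_apply_eq, insertMin_self]
  have h1 : (insertMin p π).symm 1 = p.succAbove (π.symm 0) := by
    rw [Equiv.symm_apply_eq, insertMin_succAbove, Equiv.apply_symm_apply]
    rfl
  rw [MinAdjacent, h0, h1, Fin.succAbove]
  simp only [Fin.ext_iff, Fin.lt_def]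
  split_ifs with h <;> simp at h ⊢ <;> omega

theorem signedEulerian_add_two (n : ℕ) :
    signedEulerian (n + 2) = (1 - Polynomial.X) * eulerOp n (signedEulerian n) := by
  classical
  have split : signedEulerian (n + 2) = ∑ π : Equiv.Perm (Fin (n + 2)),
      if MinAdjacent π then
        ((Equiv.Perm.sign π : ℤ) : Polynomial ℚ) * Polynomial.X ^ borderedDes π else 0 := by
    refine sub_eq_zero.mp (Eq.trans ?_ (sum_not_minAdjacent n))
    rw [signedEulerian, ← sum_sub_distrib]
    refine sum_congr rfl fun π _ => ?_
    split_ifs <;> simp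
  have collapse : ∀ π : Equiv.Perm (Fin (n + 1)), (∑ p, if MinAdjacent (insertMin p π) then
      ((Equiv.Perm.sign (insertMin p π) : ℤ) : Polynomial ℚ) *
        Polynomial.X ^ borderedDes (insertMin p π) else 0) =
      (1 - Polynomial.X) * ((-1) ^ (π.symm 0 : ℕ) *
        ((Equiv.Perm.sign π : ℤ) : Polynomial ℚ) * Polynomial.X ^ borderedDes π) := by
    intro π
    have hne : (π.symm 0).castSucc ≠ (π.symm 0).succ := by
      simp [Fin.ext_iff]
    have hz : borderedWord π ((π.symm 0 : ℕ) + 1) = 0 := (borderedWord_eq_iff π 0 _).2 rfl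
    have hb : borderedWord π (π.symm 0 : ℕ) ≠ 0 := fun h => by
      have := (borderedWord_eq_iff π 0 _).1 h
      omega
    rw [← sum_filter, show univ.filter (fun p => MinAdjacent (insertMin p π)) =
      {(π.symm 0).castSucc, (π.symm 0).succ} by ext p; simp [minAdjacent_insertMin],
      sum_pair hne]
    simp only [borderedDes_insertMin, sign_insertMin, Fin.val_castSucc, Fin.val_succ, hz,
      if_pos (Nat.pos_of_ne_zero hb), Nat.not_lt_zero, if_false]
    push_cast
    ring
  rw [split, sum_perm_succ, sum_congr rfl fun π _ => collapse π, ← mul_sum, sum_perm_succ,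
    signedEulerian, eulerOp_sum]
  refine congrArg _ (sum_congr rfl fun π _ => ?_)
  rw [eulerOp_intCast_mul, ← sum_insertMin_pow, mul_sum]
  refine sum_congr rfl fun p _ => ?_
  have hp : (insertMin p π).symm 0 = p := by
    rw [Equiv.symm_apply_eq, insertMin_self]
  rw [hp, sign_insertMin]
  push_cast
  rw [← mul_assoc ((-1) ^ (p : ℕ)), ← mul_pow]
  simp

theorem eulerOp_two_mul (k : ℕ) (f : Polynomial ℚ) :
    eulerOp (2 * k) ((1 - Polynomial.X) ^ k * f) = (1 - Polynomial.X) ^ k * eulerOp k f := by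
  rcases k with _ | k
  · simp
  · simp only [eulerOp, Polynomial.derivative_mul, Polynomial.derivative_pow,
      Polynomial.derivative_sub, Polynomial.derivative_one, Polynomial.derivative_X,
      Nat.add_sub_cancel, map_natCast]
    push_cast
    ring

theorem signedEulerian_two_mul (k : ℕ) :
    signedEulerian (2 * k) = (1 - Polynomial.X) ^ k * borderedEulerian k := by
  induction k with
  | zero => simp [signedEulerian, borderedEulerian]
  | succ k ih =>
    rw [Nat.mul_succ, signedEulerian_add_two, ih, eulerOp_two_mul, borderedEulerian_succ]
    ring

/-- The gamma coefficients of the Eulerian polynomial of order `n + 1`. -/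
def eulerGamma : ℕ → ℕ → ℕ
  | 0, 0 => 1
  | 0, _ + 1 => 0
  | n + 1, 0 => eulerGamma n 0
  | n + 1, i + 1 => (i + 2) * eulerGamma n (i + 1) + 2 * (n - 2 * i) * eulerGamma n i

theorem eulerGamma_zero_right (n : ℕ) : eulerGamma n 0 = 1 := by
  induction n with
  | zero => rfl
  | succ n ih => exact ih

theorem two_mul_le_of_eulerGamma_ne_zero {n i : ℕ} (h : eulerGamma n i ≠ 0) : 2 * i ≤ n := by
  induction n generalizing i with
  | zero =>
    rcases i with _ | i
    · rfl
    · exact absurd rfl h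
  | succ n ih =>
    rcases i with _ | i
    · omega
    · by_contra hi
      have h1 : eulerGamma n (i + 1) = 0 := by
        by_contra h1
        have := ih h1
        omega
      apply h
      rw [eulerGamma, h1, show n - 2 * i = 0 by omega]
      simp

theorem even_eulerGamma_succ (n i : ℕ) : Even (eulerGamma n (i + 1)) := by
  induction n generalizing i with
  | zero => exact Even.zero
  | succ n ih =>
    rw [eulerGamma, mul_assoc]
    exact ((ih i).mul_left _).add (even_two_mul _)

theorem eulerGamma_mod_two (m n i : ℕ) : eulerGamma m i % 2 = eulerGamma n i % 2 := by
  rcases i with _ | i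
  · rw [eulerGamma_zero_right, eulerGamma_zero_right]
  · rw [Nat.even_iff.mp (even_eulerGamma_succ m i), Nat.even_iff.mp (even_eulerGamma_succ n i)]

theorem succ_mul_eulerGamma_le (n i : ℕ) :
    (i + 1) * eulerGamma n i ≤ eulerGamma (n + 1) i := by
  rcases i with _ | i
  · simp [eulerGamma]
  · rw [eulerGamma]
    exact Nat.le_add_right _ _

theorem eulerGamma_le_succ (n i : ℕ) : eulerGamma n i ≤ eulerGamma (n + 1) i :=
  (Nat.le_mul_of_pos_left _ i.succ_pos).trans (succ_mul_eulerGamma_le n i)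

theorem eulerGamma_add_four_mul_le {n : ℕ} (hn : 2 ≤ n) (i : ℕ) :
    eulerGamma n (i + 1) + 4 * eulerGamma n i ≤ eulerGamma (n + 2) (i + 1) := by
  rw [eulerGamma, eulerGamma]
  have h := succ_mul_eulerGamma_le n i
  by_cases hi : 2 * i ≤ n
  · obtain ⟨d, rfl⟩ := Nat.exists_eq_add_of_le hi
    rw [show 2 * i + d + 1 - 2 * i = d + 1 by omega, show 2 * i + d - 2 * i = d by omega]
    have hid : 1 ≤ i ∨ 1 ≤ d := by omega
    have h2 := Nat.mul_le_mul_left (2 * (d + 1)) h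
    have h3 : 4 * eulerGamma (2 * i + d) i ≤
        ((i + 2) * (2 * d) + 2 * (d + 1) * (i + 1)) * eulerGamma (2 * i + d) i := by
      refine Nat.mul_le_mul_right _ ?_
      rcases hid with h | h <;> nlinarith
    nlinarith [Nat.zero_le (i * eulerGamma (2 * i + d) (i + 1)),
      Nat.zero_le (i * i * eulerGamma (2 * i + d) (i + 1))]
  · have h0 : eulerGamma n i = 0 := by
      by_contra h0
      exact hi (two_mul_le_of_eulerGamma_ne_zero h0)
    rw [h0]
    nlinarith [Nat.zero_le (i * eulerGamma n (i + 1)),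
      Nat.zero_le (i * i * eulerGamma n (i + 1)),
      Nat.zero_le (2 * (n + 1 - 2 * i) * eulerGamma (n + 1) i)]

/-- The polynomial with center of symmetry `N / 2` and gamma coefficients `g`. -/
noncomputable def gammaSum (N : ℕ) (g : ℕ → ℤ) : Polynomial ℚ :=
  ∑ i ∈ range (N + 1), (g i : Polynomial ℚ) *
    (Polynomial.X ^ i * (1 + Polynomial.X) ^ (N - 2 * i))

theorem gammaSum_add (N : ℕ) (f g : ℕ → ℤ) :
    gammaSum N (f + g) = gammaSum N f + gammaSum N g := by
  simp only [gammaSum, Pi.add_apply, Int.cast_add, add_mul, sum_add_distrib]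

theorem gammaSum_sub (N : ℕ) (f g : ℕ → ℤ) :
    gammaSum N (f - g) = gammaSum N f - gammaSum N g := by
  simp only [gammaSum, Pi.sub_apply, Int.cast_sub, sub_mul, sum_sub_distrib]

theorem gammaSum_succ {N : ℕ} {g : ℕ → ℤ} (hg : ∀ i, g i ≠ 0 → 2 * i ≤ N) :
    gammaSum (N + 1) g = (1 + Polynomial.X) * gammaSum N g := by
  have h0 : g (N + 1) = 0 := by
    by_contra h
    have := hg _ h
    omega
  rw [gammaSum, sum_range_succ, h0, gammaSum, mul_sum]
  simp only [Int.cast_zero, zero_mul, add_zero]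
  refine sum_congr rfl fun i _ => ?_
  by_cases hi : g i = 0
  · simp [hi]
  · have := hg i hi
    rw [show N + 1 - 2 * i = N - 2 * i + 1 by omega]
    ring

theorem sum_range_mul_add_mul_succ {R : Type*} [CommRing R] (T : ℕ → R) {a b c : ℕ → R} {M : ℕ}
    (h0 : c 0 = a 0) (hsucc : ∀ i, c (i + 1) = a (i + 1) + b i) (ha : a M = 0) :
    ∑ i ∈ range M, (a i * T i + b i * T (i + 1)) = ∑ i ∈ range (M + 1), c i * T i := by
  have h := sum_range_succ' (fun i => a i * T i) M
  rw [sum_range_succ, ha, zero_mul, add_zero] at h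
  rw [sum_add_distrib, h, sum_range_succ', h0]
  simp only [hsucc, add_mul, sum_add_distrib]
  ring

theorem eulerOp_X_mul_gamma (a b : ℕ) :
    eulerOp (2 * a + b + 1) (Polynomial.X * (Polynomial.X ^ a * (1 + Polynomial.X) ^ b)) =
      ((a : Polynomial ℚ) + 1) * (Polynomial.X * (Polynomial.X ^ a * (1 + Polynomial.X) ^ (b + 1))) +
        2 * (b : Polynomial ℚ) * (Polynomial.X * (Polynomial.X ^ (a + 1) * (1 + Polynomial.X) ^ (b - 1))) := by
  rw [← mul_assoc, ← pow_succ']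
  simp only [eulerOp, Polynomial.derivative_mul, Polynomial.derivative_pow,
    Polynomial.derivative_add, Polynomial.derivative_one, Polynomial.derivative_X, map_natCast,
    Nat.add_sub_cancel]
  rcases b with _ | b
  · push_cast
    ring
  · push_cast [Nat.add_sub_cancel]
    ring

theorem borderedEulerian_succ_eq_gammaSum (n : ℕ) :
    borderedEulerian (n + 1) = Polynomial.X * gammaSum n fun i => eulerGamma n i := by
  induction n with
  | zero =>
    rw [borderedEulerian_succ, borderedEulerian_zero]
    simp [eulerOp, gammaSum, eulerGamma]
  | succ n ih =>
    have hzero : ∀ i, n < 2 * i → eulerGamma n i = 0 := fun i hi => by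
      by_contra h
      have := two_mul_le_of_eulerGamma_ne_zero h
      omega
    rw [borderedEulerian_succ, ih, gammaSum, gammaSum, mul_sum, mul_sum, eulerOp_sum]
    have h := sum_range_mul_add_mul_succ
      (fun i => (Polynomial.X : Polynomial ℚ) *
        (Polynomial.X ^ i * (1 + Polynomial.X) ^ (n + 1 - 2 * i)))
      (a := fun i => (i + 1) * (eulerGamma n i : Polynomial ℚ))
      (b := fun i => 2 * ((n - 2 * i : ℕ) : Polynomial ℚ) * (eulerGamma n i : Polynomial ℚ))
      (c := fun i => (eulerGamma (n + 1) i : Polynomial ℚ)) (M := n + 1)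
      (by simp [eulerGamma])
      (fun i => by simp only [eulerGamma]; push_cast; ring)
      (by simp [hzero (n + 1) (by omega)])
    refine Eq.trans (sum_congr rfl fun i _ => ?_) (h.trans (sum_congr rfl fun i _ => ?_))
    · rw [mul_left_comm, eulerOp_intCast_mul]
      rcases lt_or_ge n (2 * i) with hi | hi
      · simp [hzero i hi]
      · obtain ⟨b, rfl⟩ := Nat.exists_eq_add_of_le hi
        rw [show 2 * i + b - 2 * i = b by omega, eulerOp_X_mul_gamma,
          show 2 * i + b + 1 - 2 * i = b + 1 by omega,
          show 2 * i + b + 1 - 2 * (i + 1) = b - 1 by omega]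
        push_cast
        ring
    · push_cast
      ring

/-- The effect on gamma coefficients of multiplication by `(1 - X) ^ 2`. -/
def gammaStep (g : ℕ → ℤ) : ℕ → ℤ
  | 0 => g 0
  | i + 1 => g (i + 1) - 4 * g i

theorem two_mul_le_of_gammaStep_ne_zero {N : ℕ} {g : ℕ → ℤ} (hg : ∀ i, g i ≠ 0 → 2 * i ≤ N)
    (i : ℕ) (h : gammaStep g i ≠ 0) : 2 * i ≤ N + 2 := by
  rcases i with _ | i
  · omega
  · by_contra hi
    have h1 : g (i + 1) = 0 := by
      by_contra h1
      have := hg _ h1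
      omega
    have h2 : g i = 0 := by
      by_contra h2
      have := hg _ h2
      omega
    simp [gammaStep, h1, h2] at h

theorem sq_mul_gammaSum {N : ℕ} {g : ℕ → ℤ} (hg : ∀ i, g i ≠ 0 → 2 * i ≤ N) :
    (1 - Polynomial.X) ^ 2 * gammaSum N g = gammaSum (N + 2) (gammaStep g) := by
  have hlast : gammaStep g (N + 1 + 1) = 0 := by
    by_contra h
    have := two_mul_le_of_gammaStep_ne_zero hg _ h
    omega
  have hg0 : g (N + 1) = 0 := by
    by_contra h
    have := hg _ h
    omega
  rw [gammaSum, gammaSum, mul_sum, sum_range_succ _ (N + 2), hlast]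
  simp only [Int.cast_zero, zero_mul, add_zero]
  rw [← sum_range_mul_add_mul_succ
    (fun i => (Polynomial.X : Polynomial ℚ) ^ i * (1 + Polynomial.X) ^ (N + 2 - 2 * i))
    (a := fun i => (g i : Polynomial ℚ)) (b := fun i => -4 * (g i : Polynomial ℚ))
    (c := fun i => (gammaStep g i : Polynomial ℚ)) (M := N + 1) rfl
    (fun i => by simp only [gammaStep]; push_cast; ring) (by simp [hg0])]
  refine sum_congr rfl fun i _ => ?_
  by_cases hi : g i = 0
  · simp [hi]
  · obtain ⟨b, rfl⟩ := Nat.exists_eq_add_of_le (hg i hi)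
    rw [show 2 * i + b - 2 * i = b by omega, show 2 * i + b + 2 - 2 * i = b + 2 by omega,
      show 2 * i + b + 2 - 2 * (i + 1) = b by omega]
    ring

theorem two_mul_le_of_gammaStep_iterate_ne_zero {N : ℕ} {g : ℕ → ℤ}
    (hg : ∀ i, g i ≠ 0 → 2 * i ≤ N) (k i : ℕ) (h : gammaStep^[k] g i ≠ 0) :
    2 * i ≤ N + 2 * k := by
  induction k generalizing i with
  | zero => exact hg i h
  | succ k ih =>
    rw [Function.iterate_succ_apply'] at h
    exact two_mul_le_of_gammaStep_ne_zero ih i h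

theorem pow_mul_gammaSum {N : ℕ} {g : ℕ → ℤ} (hg : ∀ i, g i ≠ 0 → 2 * i ≤ N) (k : ℕ) :
    (1 - Polynomial.X) ^ (2 * k) * gammaSum N g = gammaSum (N + 2 * k) (gammaStep^[k] g) := by
  induction k with
  | zero => simp
  | succ k ih =>
    rw [Function.iterate_succ_apply', Nat.mul_succ, ← add_assoc,
      ← sq_mul_gammaSum (two_mul_le_of_gammaStep_iterate_ne_zero hg k), ← ih]
    ring

theorem gammaStep_iterate_emod_two (g : ℕ → ℤ) (k i : ℕ) :
    gammaStep^[k] g i % 2 = g i % 2 := by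
  induction k generalizing i with
  | zero => rfl
  | succ k ih =>
    rw [Function.iterate_succ_apply', ← ih]
    rcases i with _ | i
    · rfl
    · rw [gammaStep]
      omega

theorem abs_gammaStep_iterate_le {n : ℕ} (hn : 2 ≤ n) (k i : ℕ) :
    |gammaStep^[k] (fun j => (eulerGamma n j : ℤ)) i| ≤ eulerGamma (n + 2 * k) i := by
  induction k generalizing i with
  | zero => simp
  | succ k ih =>
    rw [Function.iterate_succ_apply']
    rcases i with _ | i
    · simpa [gammaStep, eulerGamma_zero_right] using ih 0
    · rw [gammaStep]
      have h1 := abs_le.mp (ih i)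
      have h2 := abs_le.mp (ih (i + 1))
      have h3 := eulerGamma_add_four_mul_le (n := n + 2 * k) (by omega) i
      rw [Nat.mul_succ, ← add_assoc, abs_le]
      omega

theorem uniGamma_gammaSum {N : ℕ} {u : ℕ → ℕ} (hu : ∀ i, u i ≠ 0 → 2 * i ≤ N) :
    UniGamma (gammaSum N fun i => u i) N := by
  refine ⟨u, hu, ?_⟩
  rw [gammaSum]
  refine sum_congr rfl fun i _ => ?_
  simp [Polynomial.smul_eq_C_mul]

theorem uniGamma_X_mul_gammaSum {N : ℕ} {u : ℕ → ℕ} (hu : ∀ i, u i ≠ 0 → 2 * i ≤ N) :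
    UniGamma (Polynomial.X * gammaSum N fun i => u i) (N + 2) := by
  have h0 : u (N + 1) = 0 := by
    by_contra h
    have := hu _ h
    omega
  refine ⟨fun i => Nat.casesOn i 0 u, ?_, ?_⟩
  · rintro (_ | i) h
    · omega
    · have := hu i h
      omega
  · rw [sum_range_succ', show N + 2 = N + 1 + 1 from rfl, sum_range_succ, gammaSum, mul_sum]
    simp only [h0, Nat.rec_zero, Nat.cast_zero, zero_smul, add_zero]
    refine sum_congr rfl fun i _ => ?_
    rw [show N + 1 + 1 - 2 * (i + 1) = N - 2 * i by omega, Polynomial.smul_eq_C_mul]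
    simp
    ring

theorem two_mul_X_mul_AuniP (n : ℕ) :
    2 * (Polynomial.X * AuniP (n + 1)) = borderedEulerian (n + 1) + signedEulerian (n + 1) := by
  rw [AuniP, borderedEulerian, signedEulerian, sum_filter, mul_sum, mul_sum, ← sum_add_distrib]
  refine sum_congr rfl fun π _ => ?_
  rw [borderedDes_eq_desA_succ]
  rcases Int.units_eq_one_or (Equiv.Perm.sign π) with h | h
  · simp [h]
    ring
  · simp [h]

theorem AuniP_4m2_sum_two_gamma (m : ℕ) (hm : 1 ≤ m) :
    ∃ w1 w2 : Polynomial ℚ, AuniP (4*m+2) = w1 + w2 ∧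
      UniGamma w1 (4*m) ∧ UniGamma w2 (4*m+2) := by
  set c : ℕ → ℕ := eulerGamma (4 * m + 1) with hc
  set h : ℕ → ℤ := gammaStep^[m] fun i => (eulerGamma (2 * m) i : ℤ) with hh
  have hbound : ∀ i, |h i| ≤ c i := fun i => by
    refine (abs_gammaStep_iterate_le (by omega) m i).trans ?_
    rw [show 2 * m + 2 * m = 4 * m by ring]
    exact_mod_cast eulerGamma_le_succ (4 * m) i
  have hparity : ∀ i, h i % 2 = (c i : ℤ) % 2 := fun i => by
    rw [hh, gammaStep_iterate_emod_two]
    exact_mod_cast eulerGamma_mod_two (2 * m) (4 * m + 1) i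
  have hcs : ∀ i, c i ≠ 0 → 2 * i ≤ 4 * m := fun i hi => by
    have := two_mul_le_of_eulerGamma_ne_zero hi
    omega
  have hsplit : ∀ i, ∃ u v : ℕ, (c i : ℤ) = u + v ∧ h i = u - v := fun i => by
    have h1 := abs_le.mp (hbound i)
    have h2 := hparity i
    exact ⟨((c i + h i) / 2).toNat, ((c i - h i) / 2).toNat, by omega, by omega⟩
  choose u v hsum hdiff using hsplit
  refine ⟨gammaSum (4 * m) fun i => u i, Polynomial.X * gammaSum (4 * m) fun i => v i, ?_,
    uniGamma_gammaSum fun i hi => hcs i (by have := hsum i; omega),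
    uniGamma_X_mul_gammaSum fun i hi => hcs i (by have := hsum i; omega)⟩
  have hA : borderedEulerian (4 * m + 1 + 1) = Polynomial.X * ((1 + Polynomial.X) *
      (gammaSum (4 * m) (fun i => u i) + gammaSum (4 * m) fun i => v i)) := by
    rw [borderedEulerian_succ_eq_gammaSum, gammaSum_succ fun i hi => hcs i (by exact_mod_cast hi),
      ← gammaSum_add]
    exact congrArg (fun g => _ * (_ * gammaSum (4 * m) g)) (funext hsum)
  have hS : signedEulerian (4 * m + 1 + 1) = Polynomial.X * ((1 - Polynomial.X) *
      (gammaSum (4 * m) (fun i => u i) - gammaSum (4 * m) fun i => v i)) := by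
    have hpow := pow_mul_gammaSum (N := 2 * m) (g := fun i => (eulerGamma (2 * m) i : ℤ))
      (fun i hi => two_mul_le_of_eulerGamma_ne_zero (by exact_mod_cast hi)) m
    rw [← hh, show 2 * m + 2 * m = 4 * m by ring] at hpow
    rw [show 4 * m + 1 + 1 = 2 * (2 * m + 1) by ring, signedEulerian_two_mul,
      borderedEulerian_succ_eq_gammaSum, ← gammaSum_sub,
      show (fun i => (u i : ℤ)) - (fun i => (v i : ℤ)) = h from (funext hdiff).symm, ← hpow]
    ring
  have key := two_mul_X_mul_AuniP (4 * m + 1)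
  rw [hA, hS] at key
  refine mul_left_cancel₀ (mul_ne_zero two_ne_zero (Polynomial.X_ne_zero (R := ℚ))) ?_
  rw [mul_assoc, key]
  ring
end
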